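/- For every A = ((a,b),(c,d)) ∈ SL(2,ℤ) with A ≡ I (mod 2), every k ∈ {2,3,4} and every τ ∈ ℍ: X_k^∞((aτ+b)/(cτ+d)) = (cτ+d)²·X_k^∞(τ) + c(cτ+d). (In other words, each X_k^∞ is a quasi-modular form of weight 2 and depth 1 on the principal congruence subgroup Γ(2).) -/

import Mathlib

open Complex

/-- The theta-constant `ϑ₂(τ) = ∑_{n∈ℤ} q^{(n-1/2)²}`, `q = exp(πiτ)`. -/
noncomputable def theta2 (τ : ℂ) : ℂ :=
  ∑' n : ℤ, Complex.exp (Real.pi * Complex.I * τ * ((n : ℂ) - 1 / 2) ^ 2)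

/-- The theta-constant `ϑ₃(τ) = ∑_{n∈ℤ} q^{n²}`, `q = exp(πiτ)`. -/
noncomputable def theta3 (τ : ℂ) : ℂ :=
  ∑' n : ℤ, Complex.exp (Real.pi * Complex.I * τ * (n : ℂ) ^ 2)

/-- The theta-constant `ϑ₄(τ) = ∑_{n∈ℤ} (-1)ⁿ q^{n²}`, `q = exp(πiτ)`. -/
noncomputable def theta4 (τ : ℂ) : ℂ :=
  ∑' n : ℤ, (-1 : ℂ) ^ n * Complex.exp (Real.pi * Complex.I * τ * (n : ℂ) ^ 2)

/-- `X₂^∞ = 2 ϑ₂'/ϑ₂`. -/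
noncomputable def X2 (τ : ℂ) : ℂ := 2 * deriv theta2 τ / theta2 τ

/-- `X₃^∞ = 2 ϑ₃'/ϑ₃`. -/
noncomputable def X3 (τ : ℂ) : ℂ := 2 * deriv theta3 τ / theta3 τ

/-- `X₄^∞ = 2 ϑ₄'/ϑ₄`. -/
noncomputable def X4 (τ : ℂ) : ℂ := 2 * deriv theta4 τ / theta4 τ

open UpperHalfPlane hiding I
open ModularGroup EisensteinSeries
open scoped MatrixGroups ModularForm

section ThetaConstants

lemma theta3_eq_jacobiTheta (τ : ℂ) : theta3 τ = jacobiTheta τ :=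
  tsum_congr fun n ↦ by ring_nf

lemma theta3_eq_jacobiTheta₂ (τ : ℂ) : theta3 τ = jacobiTheta₂ 0 τ := by
  rw [theta3_eq_jacobiTheta, jacobiTheta_eq_jacobiTheta₂]

lemma theta4_eq_jacobiTheta₂ (τ : ℂ) : theta4 τ = jacobiTheta₂ (1 / 2) τ := by
  refine tsum_congr fun n ↦ ?_
  rw [jacobiTheta₂_term, Complex.exp_add, ← Complex.exp_pi_mul_I, ← Complex.exp_int_mul]
  ring_nf

lemma theta2_eq_jacobiTheta₂ (τ : ℂ) :
    theta2 τ = cexp (Real.pi * I * τ / 4) * jacobiTheta₂ (-τ / 2) τ := by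
  rw [theta2, jacobiTheta₂, ← tsum_mul_left]
  refine tsum_congr fun n ↦ ?_
  rw [jacobiTheta₂_term, ← Complex.exp_add]
  ring_nf

lemma differentiableAt_theta3 {τ : ℂ} (hτ : 0 < τ.im) : DifferentiableAt ℂ theta3 τ := by
  simpa only [funext theta3_eq_jacobiTheta₂] using differentiableAt_jacobiTheta₂_snd 0 hτ

lemma differentiableAt_theta4 {τ : ℂ} (hτ : 0 < τ.im) : DifferentiableAt ℂ theta4 τ := by
  simpa only [funext theta4_eq_jacobiTheta₂] using differentiableAt_jacobiTheta₂_snd (1 / 2) hτ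

lemma differentiableAt_theta2 {τ : ℂ} (hτ : 0 < τ.im) : DifferentiableAt ℂ theta2 τ := by
  rw [funext theta2_eq_jacobiTheta₂]
  have h : DifferentiableAt ℂ (fun t : ℂ ↦ jacobiTheta₂ (-t / 2) t) τ :=
    (hasFDerivAt_jacobiTheta₂ (-τ / 2) hτ).differentiableAt.comp τ
      (f := fun t : ℂ ↦ (-t / 2, t)) (by fun_prop)
  exact DifferentiableAt.mul (by fun_prop) h

lemma theta3_one_add (τ : ℂ) : theta3 (1 + τ) = theta4 τ := by
  refine tsum_congr fun n ↦ ?_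
  have h : cexp (Real.pi * I * (n : ℂ) ^ 2) = (-1) ^ n := by
    rw [show (Real.pi * I * (n : ℂ) ^ 2 : ℂ) = ((n ^ 2 : ℤ) : ℂ) * (Real.pi * I) by
      push_cast; ring, Complex.exp_int_mul, Complex.exp_pi_mul_I]
    rcases Int.even_or_odd n with hn | hn
    · rw [hn.neg_one_zpow, (hn.pow_of_ne_zero two_ne_zero).neg_one_zpow]
    · rw [hn.neg_one_zpow, hn.pow.neg_one_zpow]
  rw [mul_add, add_mul, Complex.exp_add, mul_one, h]

lemma theta4_one_add (τ : ℂ) : theta4 (1 + τ) = theta3 τ := by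
  rw [← theta3_one_add, theta3_eq_jacobiTheta, theta3_eq_jacobiTheta, ← jacobiTheta_two_add τ]
  ring_nf

lemma theta2_one_add (τ : ℂ) : theta2 (1 + τ) = cexp (Real.pi * I / 4) * theta2 τ := by
  rw [theta2, theta2, ← tsum_mul_left]
  refine tsum_congr fun n ↦ ?_
  obtain ⟨m, hm⟩ := Int.even_mul_pred_self n
  have hm' : (n : ℂ) * (n - 1) = m + m := by exact_mod_cast hm
  rw [← Complex.exp_add, Complex.exp_eq_exp_iff_exists_int]
  exact ⟨m, by linear_combination (Real.pi * I) * hm'⟩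

lemma theta3_eq_S (τ : ℂ) : theta3 τ = 1 / (-I * τ) ^ (1 / 2 : ℂ) * theta3 (-1 / τ) := by
  rw [theta3_eq_jacobiTheta₂, theta3_eq_jacobiTheta₂, jacobiTheta₂_functional_equation]
  simp

lemma theta4_eq_S {τ : ℂ} (hτ : τ ≠ 0) :
    theta4 τ = 1 / (-I * τ) ^ (1 / 2 : ℂ) * theta2 (-1 / τ) := by
  rw [theta4_eq_jacobiTheta₂, theta2_eq_jacobiTheta₂, jacobiTheta₂_functional_equation, mul_assoc]
  congr 3 <;> field_simp
  norm_num

lemma theta2_eq_S {τ : ℂ} (hτ : τ ≠ 0) :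
    theta2 τ = 1 / (-I * τ) ^ (1 / 2 : ℂ) * theta4 (-1 / τ) := by
  rw [theta4_eq_jacobiTheta₂, theta2_eq_jacobiTheta₂, jacobiTheta₂_functional_equation (-τ / 2),
    show -τ / 2 / τ = -(1 / 2) by field_simp, jacobiTheta₂_neg_left, ← mul_assoc,
    mul_left_comm, ← Complex.exp_add,
    show Real.pi * I * τ / 4 + -Real.pi * I * (-τ / 2) ^ 2 / τ = 0 by field_simp; ring]
  simp

end ThetaConstants

section Nonvanishing

lemma exp_neg_pi_mul_lt {y : ℝ} (hy : 1 / 2 ≤ y) : Real.exp (-Real.pi * y) < 1 / 3 := by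
  have h : Real.exp (-Real.pi * y) ≤ Real.exp (-(3 / 2)) :=
    Real.exp_le_exp.mpr (by nlinarith [Real.pi_gt_three])
  have h2 : Real.exp (3 / 2) ^ 2 = Real.exp 1 ^ 3 := by
    rw [← Real.exp_nat_mul, ← Real.exp_nat_mul]; norm_num
  have h3 : 3 < Real.exp (3 / 2) := by
    have := Real.exp_one_gt_d9
    have h4 : (2.7 : ℝ) ^ 3 < Real.exp 1 ^ 3 := by gcongr; linarith
    nlinarith [Real.exp_pos (3 / 2)]
  refine h.trans_lt ?_
  rw [Real.exp_neg, ← one_div]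
  gcongr

lemma theta3_ne_zero_of_half_le_im {τ : ℂ} (hτ : 1 / 2 ≤ τ.im) : theta3 τ ≠ 0 := by
  intro h
  have h1 := norm_jacobiTheta_sub_one_le (τ := τ) (by linarith)
  have h2 := exp_neg_pi_mul_lt hτ
  rw [← theta3_eq_jacobiTheta, h, zero_sub, norm_neg, norm_one, div_mul_eq_mul_div,
    le_div_iff₀ (by linarith)] at h1
  linarith

lemma theta4_ne_zero_of_half_le_im {τ : ℂ} (hτ : 1 / 2 ≤ τ.im) : theta4 τ ≠ 0 := by
  rw [← theta3_one_add]
  exact theta3_ne_zero_of_half_le_im (by simpa using hτ)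

lemma theta2_eq_tsum_nat {τ : ℂ} (hτ : 0 < τ.im) :
    theta2 τ = 2 * cexp (Real.pi * I * τ / 4) *
      ∑' n : ℕ, cexp (Real.pi * I * τ * (n * (n + 1))) := by
  set f : ℤ → ℂ := fun n ↦ cexp (Real.pi * I * τ * (n * (n + 1)))
  have hf : (fun n ↦ jacobiTheta₂_term n (τ / 2) τ) = f := by
    ext n
    simp only [jacobiTheta₂_term, f]
    ring_nf
  have hs : Summable f := hf ▸ (hasSum_jacobiTheta₂_term (τ / 2) hτ).summable
  have hn : Summable (fun n : ℕ ↦ f n) := hs.comp_injective Nat.cast_injective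
  have hneg : (fun n : ℕ ↦ f (-(n + 1))) = fun n : ℕ ↦ f n := by
    ext n
    simp only [f]
    push_cast
    ring_nf
  rw [theta2_eq_jacobiTheta₂, neg_div, jacobiTheta₂_neg_left, jacobiTheta₂, hf,
    tsum_of_nat_of_neg_add_one hn (by rwa [hneg]), hneg]
  simp only [f, Int.cast_natCast]
  ring

lemma theta2_ne_zero_of_half_le_im {τ : ℂ} (hτ : 1 / 2 ≤ τ.im) : theta2 τ ≠ 0 := by
  have hτ0 : 0 < τ.im := by linarith
  set r := Real.exp (-Real.pi * τ.im)
  have hr : r < 1 / 3 := exp_neg_pi_mul_lt hτ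
  have hr0 : 0 < r := Real.exp_pos _
  have hle (n : ℕ) : ‖cexp (Real.pi * I * τ * (n * (n + 1)))‖ ≤ r ^ n := by
    have hre : (Real.pi * I * τ * (n * (n + 1)) : ℂ).re
        = -Real.pi * τ.im * (n * (n + 1)) := by
      rw [show (Real.pi * I * τ * (n * (n + 1)) : ℂ)
        = ((Real.pi * (n * (n + 1)) : ℝ) : ℂ) * (I * τ) by push_cast; ring, Complex.re_ofReal_mul]
      simp
      ring
    rw [Complex.norm_exp, hre, ← Real.exp_nat_mul, Real.exp_le_exp]
    have : 0 ≤ Real.pi * τ.im * (n * n) := by positivity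
    linarith
  have hg := hasSum_geometric_of_lt_one hr0.le (by linarith)
  have hs : Summable fun n : ℕ ↦ cexp (Real.pi * I * τ * (n * (n + 1))) :=
    .of_norm_bounded hg.summable hle
  have hb : ‖∑' n : ℕ, cexp (Real.pi * I * τ * ((n + 1 : ℕ) * ((n + 1 : ℕ) + 1)))‖
      ≤ r * (1 - r)⁻¹ :=
    tsum_of_norm_bounded (hg.mul_left r) fun n ↦ (hle (n + 1)).trans_eq (pow_succ' r n)
  rw [theta2_eq_tsum_nat hτ0, hs.tsum_eq_zero_add]
  refine mul_ne_zero (mul_ne_zero two_ne_zero (Complex.exp_ne_zero _)) fun h ↦ ?_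
  rw [eq_neg_of_add_eq_zero_right h, norm_neg,
    ← div_eq_mul_inv, le_div_iff₀ (by linarith)] at hb
  simp at hb
  linarith

end Nonvanishing

section Generators

lemma coe_S_smul (z : ℍ) : ((S • z : ℍ) : ℂ) = -1 / z := by
  rw [modular_S_smul]
  simp [neg_div, inv_neg]

lemma coe_T_smul (z : ℍ) : ((T • z : ℍ) : ℂ) = 1 + z := by
  rw [modular_T_smul]
  simp

lemma neg_I_mul_mem_slitPlane (z : ℍ) : -I * (z : ℂ) ∈ Complex.slitPlane :=
  Or.inl (by simpa using z.im_pos)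

lemma neg_I_mul_cpow_ne_zero (z : ℍ) : (-I * (z : ℂ)) ^ (1 / 2 : ℂ) ≠ 0 := by
  simp [Complex.cpow_eq_zero_iff, z.ne_zero]

end Generators

section Nonvanishing

lemma theta_prod_smul_ne_zero_iff (γ : SL(2, ℤ)) : ∀ z : ℍ,
    theta2 (γ • z : ℍ) * theta3 (γ • z : ℍ) * theta4 (γ • z : ℍ) ≠ 0 ↔
      theta2 z * theta3 z * theta4 z ≠ 0 := by
  have hγ : γ ∈ Subgroup.closure {S, T} := by simp [SpecialLinearGroup.SL2Z_generators]
  induction hγ using Subgroup.closure_induction with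
  | one => simp
  | mem g hg =>
    intro z
    rcases hg with rfl | rfl
    · have hA := neg_I_mul_cpow_ne_zero z
      rw [coe_S_smul, theta2_eq_S z.ne_zero, theta3_eq_S z, theta4_eq_S z.ne_zero]
      simp only [one_div, ne_eq, mul_eq_zero, inv_eq_zero, not_or] at hA ⊢
      tauto
    · rw [coe_T_smul, theta2_one_add, theta3_one_add, theta4_one_add]
      simp only [ne_eq, mul_eq_zero, Complex.exp_ne_zero, not_or]
      tauto
  | mul g h _ _ ihg ihh => exact fun z ↦ by rw [mul_smul, ihg, ihh]
  | inv g _ ih => exact fun z ↦ by rw [← ih, smul_inv_smul]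

lemma theta_prod_ne_zero (z : ℍ) : theta2 z * theta3 z * theta4 z ≠ 0 := by
  obtain ⟨γ, hγ⟩ := exists_one_half_le_im_smul z
  rw [← theta_prod_smul_ne_zero_iff γ]
  exact mul_ne_zero (mul_ne_zero (theta2_ne_zero_of_half_le_im hγ)
    (theta3_ne_zero_of_half_le_im hγ)) (theta4_ne_zero_of_half_le_im hγ)

lemma theta2_ne_zero (z : ℍ) : theta2 z ≠ 0 :=
  left_ne_zero_of_mul (left_ne_zero_of_mul (theta_prod_ne_zero z))

lemma theta3_ne_zero (z : ℍ) : theta3 z ≠ 0 :=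
  right_ne_zero_of_mul (left_ne_zero_of_mul (theta_prod_ne_zero z))

lemma theta4_ne_zero (z : ℍ) : theta4 z ≠ 0 :=
  right_ne_zero_of_mul (theta_prod_ne_zero z)

end Nonvanishing

section SlashAction

/-- Twice the logarithmic derivative of `f`, restricted to the upper half-plane. -/
noncomputable def twoLogDeriv (f : ℂ → ℂ) (z : ℍ) : ℂ := 2 * logDeriv f z

lemma twoLogDeriv_slash_T {f g : ℂ → ℂ} {k : ℂ} (hk : k ≠ 0)
    (h : ∀ τ, f (1 + τ) = k * g τ) :
    twoLogDeriv f ∣[(2 : ℤ)] T = twoLogDeriv g + (2 * Real.pi * I)⁻¹ • D2 T := by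
  ext z
  have hd : logDeriv f (1 + z) = logDeriv g z := by
    rw [← logDeriv_const_mul (f := g) (z : ℂ) k hk, ← funext h, logDeriv_apply, logDeriv_apply,
      deriv_comp_const_add]
  have hden : denom T z = 1 := by rw [denom_apply]; simp [T]
  simp only [ModularForm.SL_slash_apply, twoLogDeriv, Pi.add_apply, Pi.smul_apply, D2_T, coe_T_smul,
    hd, hden]
  simp

lemma logDeriv_one_div_neg_I_mul_cpow (z : ℍ) :
    logDeriv (fun τ : ℂ ↦ 1 / (-I * τ) ^ (1 / 2 : ℂ)) z = -1 / (2 * z) := by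
  have hz := z.ne_zero
  have hA := neg_I_mul_cpow_ne_zero z
  have hd : HasDerivAt (fun τ : ℂ ↦ (-I * τ) ^ (1 / 2 : ℂ))
      (1 / 2 * (-I * (z : ℂ)) ^ (1 / 2 - 1 : ℂ) * (-I)) z := by
    simpa using ((hasDerivAt_id (z : ℂ)).const_mul (-I)).cpow_const (c := 1 / 2)
      (neg_I_mul_mem_slitPlane z)
  rw [logDeriv_div (f := fun _ ↦ (1 : ℂ)) (z : ℂ) one_ne_zero hA (by fun_prop)
    hd.differentiableAt, logDeriv_const,
    logDeriv_apply, hd.deriv, Complex.cpow_sub _ _ (by simp [hz]), Complex.cpow_one, Pi.zero_apply]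
  have hI := Complex.I_ne_zero
  field_simp
  ring

lemma twoLogDeriv_slash_S {f g : ℂ → ℂ} (hg : ∀ z : ℍ, DifferentiableAt ℂ g z)
    (hg0 : ∀ z : ℍ, g z ≠ 0)
    (h : ∀ τ, τ ≠ 0 → f τ = 1 / (-I * τ) ^ (1 / 2 : ℂ) * g (-1 / τ)) :
    twoLogDeriv g ∣[(2 : ℤ)] S = twoLogDeriv f + (2 * Real.pi * I)⁻¹ • D2 S := by
  ext z
  have hz := z.ne_zero
  have hA := neg_I_mul_cpow_ne_zero z
  have hdA : DifferentiableAt ℂ (fun τ : ℂ ↦ (-I * τ) ^ (1 / 2 : ℂ)) z :=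
    DifferentiableAt.cpow_const (by fun_prop) (neg_I_mul_mem_slitPlane z)
  have hgS : DifferentiableAt ℂ g (-1 / z) := coe_S_smul z ▸ hg (S • z)
  have hgS0 : g (-1 / z) ≠ 0 := coe_S_smul z ▸ hg0 (S • z)
  have hinv : HasDerivAt (fun τ : ℂ ↦ -1 / τ) (1 / (z : ℂ) ^ 2) z := by
    simpa [div_eq_mul_inv] using (hasDerivAt_inv hz).const_mul (-1)
  have hd : logDeriv f z = -1 / (2 * z) + logDeriv g (-1 / z) * (1 / (z : ℂ) ^ 2) := by
    have hcongr : f =ᶠ[nhds (z : ℂ)] fun τ ↦ 1 / (-I * τ) ^ (1 / 2 : ℂ) * (g ∘ (-1 / ·)) τ := by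
      filter_upwards [isOpen_ne.mem_nhds hz] with τ hτ using h τ hτ
    have hmul := logDeriv_mul (f := fun τ : ℂ ↦ 1 / (-I * τ) ^ (1 / 2 : ℂ)) (g := g ∘ (-1 / ·))
      (z : ℂ) (one_div_ne_zero hA) hgS0 (DifferentiableAt.fun_div (by fun_prop) hdA hA)
      (hgS.comp (z : ℂ) hinv.differentiableAt)
    rw [logDeriv_one_div_neg_I_mul_cpow, logDeriv_comp hgS hinv.differentiableAt, hinv.deriv]
      at hmul
    exact (logDeriv_congr_nhds hcongr).self_of_nhds.trans hmul
  have hpi : (Real.pi : ℂ) ≠ 0 := by exact_mod_cast Real.pi_ne_zero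
  have hI := Complex.I_ne_zero
  simp only [ModularForm.SL_slash_apply, twoLogDeriv, Pi.add_apply, Pi.smul_apply, D2_S,
    coe_S_smul, hd, smul_eq_mul, denom_S]
  field_simp
  ring

/-- The theta constants, indexed by the nonzero vectors of `(ℤ/2ℤ)²`, on which `SL(2, ℤ)` acts
from the right. The value at the zero vector is irrelevant. -/
noncomputable def thetaConstant (v : Fin 2 → ZMod 2) : ℂ → ℂ :=
  if v = ![0, 1] then theta2 else if v = ![1, 0] then theta4 else theta3

lemma twoLogDeriv_thetaConstant_slash (γ : SL(2, ℤ)) : ∀ v : Fin 2 → ZMod 2, v ≠ 0 →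
    twoLogDeriv (thetaConstant v) ∣[(2 : ℤ)] γ =
      twoLogDeriv (thetaConstant (Matrix.vecMul v (γ.map (Int.castRingHom (ZMod 2))).1)) +
        (2 * Real.pi * I)⁻¹ • D2 γ := by
  have hγ : γ ∈ Subgroup.closure {S, T} := by simp [SpecialLinearGroup.SL2Z_generators]
  have hcases : ∀ v : Fin 2 → ZMod 2, v ≠ 0 → v = ![0, 1] ∨ v = ![1, 0] ∨ v = ![1, 1] := by
    decide
  have hne (A : Matrix.SpecialLinearGroup (Fin 2) (ZMod 2)) (v : Fin 2 → ZMod 2) (hv : v ≠ 0) :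
      Matrix.vecMul v A.1 ≠ 0 := by
    intro h
    apply hv
    rw [← Matrix.vecMul_one v, ← Matrix.SpecialLinearGroup.coe_one, ← mul_inv_cancel A,
      Matrix.SpecialLinearGroup.coe_mul, ← Matrix.vecMul_vecMul, h, Matrix.zero_vecMul]
  induction hγ using Subgroup.closure_induction with
  | one => simp [D2_one]
  | mem g hg =>
    intro v hv
    rcases hg with rfl | rfl
    · have h1 : Matrix.vecMul ![0, 1] (S.map (Int.castRingHom (ZMod 2))).1 = ![1, 0] := by decide
      have h2 : Matrix.vecMul ![1, 0] (S.map (Int.castRingHom (ZMod 2))).1 = ![0, 1] := by decide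
      have h3 : Matrix.vecMul ![1, 1] (S.map (Int.castRingHom (ZMod 2))).1 = ![1, 1] := by decide
      rcases hcases v hv with rfl | rfl | rfl
      · rw [h1]
        exact twoLogDeriv_slash_S (fun z ↦ differentiableAt_theta2 z.im_pos) theta2_ne_zero
          fun τ ↦ theta4_eq_S
      · rw [h2]
        exact twoLogDeriv_slash_S (fun z ↦ differentiableAt_theta4 z.im_pos) theta4_ne_zero
          fun τ ↦ theta2_eq_S
      · rw [h3]
        exact twoLogDeriv_slash_S (fun z ↦ differentiableAt_theta3 z.im_pos) theta3_ne_zero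
          fun τ _ ↦ theta3_eq_S τ
    · have h1 : Matrix.vecMul ![0, 1] (T.map (Int.castRingHom (ZMod 2))).1 = ![0, 1] := by decide
      have h2 : Matrix.vecMul ![1, 0] (T.map (Int.castRingHom (ZMod 2))).1 = ![1, 1] := by decide
      have h3 : Matrix.vecMul ![1, 1] (T.map (Int.castRingHom (ZMod 2))).1 = ![1, 0] := by decide
      rcases hcases v hv with rfl | rfl | rfl
      · rw [h1]
        exact twoLogDeriv_slash_T (Complex.exp_ne_zero _) theta2_one_add
      · rw [h2]
        exact twoLogDeriv_slash_T one_ne_zero fun τ ↦ (theta4_one_add τ).trans (one_mul _).symm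
      · rw [h3]
        exact twoLogDeriv_slash_T one_ne_zero fun τ ↦ (theta3_one_add τ).trans (one_mul _).symm
  | mul g h _ _ ihg ihh =>
    intro v hv
    rw [SlashAction.slash_mul, ihg v hv, SlashAction.add_slash, ihh _ (hne _ v hv),
      ModularForm.SL_smul_slash, D2_mul, map_mul, Matrix.SpecialLinearGroup.coe_mul,
      Matrix.vecMul_vecMul, smul_add]
    abel
  | inv g _ ih =>
    intro v hv
    have key := congrArg (· ∣[(2 : ℤ)] g⁻¹) (ih _ (hne (g⁻¹.map (Int.castRingHom (ZMod 2))) v hv))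
    simp only [← SlashAction.slash_mul, mul_inv_cancel, SlashAction.slash_one,
      SlashAction.add_slash, ModularForm.SL_smul_slash, D2_inv, Matrix.vecMul_vecMul,
      ← Matrix.SpecialLinearGroup.coe_mul, ← map_mul, inv_mul_cancel, map_one,
      Matrix.SpecialLinearGroup.coe_one, Matrix.vecMul_one] at key
    rw [key, smul_neg, neg_add_cancel_right]

lemma two_mul_logDeriv_thetaConstant_smul {γ : SL(2, ℤ)}
    (hγ : γ.map (Int.castRingHom (ZMod 2)) = 1) {v : Fin 2 → ZMod 2} (hv : v ≠ 0) (z : ℍ) :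
    2 * logDeriv (thetaConstant v) ((γ 0 0 * z + γ 0 1) / (γ 1 0 * z + γ 1 1)) =
      (γ 1 0 * z + γ 1 1) ^ 2 * (2 * logDeriv (thetaConstant v) z) +
        γ 1 0 * (γ 1 0 * z + γ 1 1) := by
  have h := congrFun (twoLogDeriv_thetaConstant_slash γ v hv) z
  have hden := denom_ne_zero γ z
  have hpi : (Real.pi : ℂ) ≠ 0 := by exact_mod_cast Real.pi_ne_zero
  have hI := Complex.I_ne_zero
  have hcoe : ((γ • z : ℍ) : ℂ) = (γ 0 0 * z + γ 0 1) / (γ 1 0 * z + γ 1 1) := by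
    rw [coe_specialLinearGroup_apply]
    simp
  have hD2 : (2 * Real.pi * I : ℂ)⁻¹ * D2 γ z = γ 1 0 / denom γ z := by
    rw [D2]
    field_simp
  rw [ModularForm.SL_slash_apply, hγ, Matrix.SpecialLinearGroup.coe_one, Matrix.vecMul_one,
    Pi.add_apply, Pi.smul_apply, smul_eq_mul, hD2, zpow_neg, ← div_eq_mul_inv,
    div_eq_iff (zpow_ne_zero 2 hden), twoLogDeriv, twoLogDeriv, hcoe] at h
  rw [h]
  rw [denom_apply] at hden ⊢
  field_simp

end SlashAction

/-- Each `X_k^∞` (k = 2,3,4) is quasi-modular of weight 2 and depth 1 on `Γ(2)`: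
for `A = ((a,b),(c,d)) ∈ SL(2,ℤ)` with `A ≡ I (mod 2)` and `τ ∈ ℍ`,
`X_k^∞((aτ+b)/(cτ+d)) = (cτ+d)² X_k^∞(τ) + c(cτ+d)`. -/
theorem Xk_quasimodular_Gamma2
    (a b c d : ℤ) (hdet : a * d - b * c = 1)
    (ha : a % 2 = 1) (hb : b % 2 = 0) (hc : c % 2 = 0) (hd : d % 2 = 1)
    (τ : ℂ) (hτ : 0 < τ.im) :
    X2 (((a : ℂ) * τ + (b : ℂ)) / ((c : ℂ) * τ + (d : ℂ)))
        = ((c : ℂ) * τ + (d : ℂ)) ^ 2 * X2 τ + (c : ℂ) * ((c : ℂ) * τ + (d : ℂ)) ∧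
    X3 (((a : ℂ) * τ + (b : ℂ)) / ((c : ℂ) * τ + (d : ℂ)))
        = ((c : ℂ) * τ + (d : ℂ)) ^ 2 * X3 τ + (c : ℂ) * ((c : ℂ) * τ + (d : ℂ)) ∧
    X4 (((a : ℂ) * τ + (b : ℂ)) / ((c : ℂ) * τ + (d : ℂ)))
        = ((c : ℂ) * τ + (d : ℂ)) ^ 2 * X4 τ + (c : ℂ) * ((c : ℂ) * τ + (d : ℂ)) := by
  let γ : SL(2, ℤ) := ⟨!![a, b; c, d], by rw [Matrix.det_fin_two_of, hdet]⟩
  have hγ : γ.map (Int.castRingHom (ZMod 2)) = 1 := by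
    have h1 (n : ℤ) (hn : n % 2 = 1) : (n : ZMod 2) = 1 := by
      exact_mod_cast (ZMod.intCast_eq_intCast_iff n 1 2).mpr hn
    have h0 (n : ℤ) (hn : n % 2 = 0) : (n : ZMod 2) = 0 := by
      exact_mod_cast (ZMod.intCast_eq_intCast_iff n 0 2).mpr hn
    ext i j
    rw [Matrix.SpecialLinearGroup.map_apply_coe]
    fin_cases i <;> fin_cases j <;> simp [γ, h0, h1, ha, hb, hc, hd]
  have key {v : Fin 2 → ZMod 2} (hv : v ≠ 0) :=
    two_mul_logDeriv_thetaConstant_smul hγ hv ⟨τ, hτ⟩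
  have h2 := key (v := ![0, 1]) (by decide)
  have h3 := key (v := ![1, 1]) (by decide)
  have h4 := key (v := ![1, 0]) (by decide)
  simp only [X2, X3, X4, mul_div_assoc, ← logDeriv_apply]
  exact ⟨h2, h3, h4⟩
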